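/- arXiv:2601.14317 — 2 statements merged into one kernel-verified Lean document; each statement's English description precedes it below -/
import Mathlib

section
/- Let E be a two-dimensional real normed space and K ⊆ E a nonempty compact convex set that is non-centrable (i.e., diam K < 2·λ_K), and let B(x, λ_K) be a minimal enclosing ball of K (i.e., x ∈ Ch(K)). Then there exist m ∈ {2, 3} and affinely independent points t₁, …, t_m ∈ cr(K, x) such that x lies in the relative interior of conv{t₁, …, t_m}. -/
open Metric Set

variable {E : Type*} [NormedAddCommGroup E] [NormedSpace ℝ E] [FiniteDimensional ℝ E]

/-- The Chebyshev radius of a set: the smallest `r` such that `K` is contained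
in a closed ball of radius `r`. -/
noncomputable def chebRadius (K : Set E) : ℝ :=
  sInf {r : ℝ | ∃ x : E, K ⊆ Metric.closedBall x r}

/-- The `r`-ball intersection of `K`. -/
def ballInt (K : Set E) (r : ℝ) : Set E :=
  ⋂ x ∈ K, Metric.closedBall x r

/-- The `r`-ball hull of `K`. -/
def ballHull (K : Set E) (r : ℝ) : Set E :=
  ⋂ x ∈ {x : E | K ⊆ Metric.closedBall x r}, Metric.closedBall x r

/-- The Chebyshev set of `K`: centers of minimal enclosing balls of `K`. -/
noncomputable def chebSet (K : Set E) : Set E :=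
  {x : E | K ⊆ Metric.closedBall x (chebRadius K)}

/-- A bounded set is (diametrically) complete if adding any new point
increases its diameter. -/
def IsDiamComplete (C : Set E) : Prop :=
  Bornology.IsBounded C ∧ ∀ x ∉ C, Metric.diam C < Metric.diam (C ∪ {x})

/-- `Kc` is a completion of `K`: a complete set containing `K` with the same diameter. -/
def IsCompletion (Kc K : Set E) : Prop :=
  IsDiamComplete Kc ∧ K ⊆ Kc ∧ Metric.diam Kc = Metric.diam K

/-- The critical set of `K` with respect to a Chebyshev center `x`. -/
noncomputable def critSet (K : Set E) (x : E) : Set E :=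
  K ∩ Metric.sphere x (chebRadius K)

/-- Obstruction to a positive relation `p φ₁ + φ₂ + q φ₃ = 0` among supporting functionals
when the middle contact point is `α c₁ + β c₃`, in the case `0 < φ₂ c₃`;
here `s = φ₁ c₃` and `t = φ₃ c₁`. -/
lemma false_of_support_values {α β p q s t : ℝ} (hα : 0 ≤ α) (hβ : 0 ≤ β) (hp : 0 < p)
    (hq : 0 < q) (hs : -1 < s) (ht : -1 < t) (ha : p + q * t < 1) (hu : 0 < -(p * s + q))
    (h2 : -α * (p + q * t) - β * (p * s + q) = 1) (h3 : α * t + β ≤ 1) : False := by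
  have hupq : -(p * s + q) ≤ p - q := by nlinarith
  have h4 : β * -(p * s + q) ≤ (1 - α * t) * (p - q) :=
    mul_le_mul (by linarith) hupq hu.le (by linarith)
  have h5 : 0 ≤ α * p * (1 + t) := by
    have : 0 ≤ 1 + t := by linarith
    positivity
  have h6 : 0 < q * (1 + t) := mul_pos hq (by linarith)
  nlinarith

/-- Supporting functionals at three unit vectors, one of which lies in the cone spanned by the
other two, satisfy no positive linear relation unless two of the vectors are at distance `2`. -/
lemma false_of_mem_cone {V : Type*} [AddCommGroup V] [Module ℝ V] {φ : Fin 3 → V →ₗ[ℝ] ℝ}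
    {c : Fin 3 → V} {w : Fin 3 → ℝ} (h1 : ∀ i, φ i (c i) = 1) (hle : ∀ i j, φ i (c j) ≤ 1)
    (hgt : ∀ i j, -1 < φ i (c j)) (hw : ∀ i, 0 < w i) {i j k : Fin 3} {α β : ℝ}
    (hrel : ∀ v, w i * φ i v + w j * φ j v + w k * φ k v = 0)
    (hα : 0 ≤ α) (hβ : 0 ≤ β) (hc : c j = α • c i + β • c k) : False := by
  obtain ⟨p, hp, hpw⟩ : ∃ p, 0 < p ∧ w i = w j * p :=
    ⟨w i / w j, div_pos (hw i) (hw j), by rw [mul_div_cancel₀ _ (hw j).ne']⟩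
  obtain ⟨q, hq, hqw⟩ : ∃ q, 0 < q ∧ w k = w j * q :=
    ⟨w k / w j, div_pos (hw k) (hw j), by rw [mul_div_cancel₀ _ (hw j).ne']⟩
  have hφ (v : V) : φ j v = -(p * φ i v + q * φ k v) := by
    have h := hrel v
    rw [hpw, hqw] at h
    have : w j * (p * φ i v + φ j v + q * φ k v) = 0 := by linarith
    rcases mul_eq_zero.1 this with h | h
    · exact absurd h (hw j).ne'
    · linarith
  have hi := hφ (c i)
  have hk := hφ (c k)
  have hjj := h1 j
  have hij := hle i j
  have hkj := hle k j
  have hji' := hgt j i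
  have hjk' := hgt j k
  simp only [h1, mul_one] at hi hk
  rw [hc] at hjj hij hkj
  simp only [map_add, map_smul, smul_eq_mul, h1, mul_one] at hjj hij hkj
  rcases lt_or_ge 0 (φ j (c k)) with h | h
  · refine false_of_support_values hα hβ hp hq (hgt i k) (hgt k i) ?_ ?_ ?_ hkj
    · linarith
    · linarith
    · rw [hi, hk] at hjj; linarith
  · have h' : 0 < φ j (c i) := by
      by_contra! h'
      nlinarith
    refine false_of_support_values hβ hα hq hp (hgt k i) (hgt i k) ?_ ?_ ?_ ?_
    · linarith
    · linarith
    · rw [hi, hk] at hjj; linarith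
    · linarith

/-- Among three vectors in an open half-plane, one lies in the cone spanned by the others. -/
lemma exists_mem_cone_of_half_plane {V : Type*} [AddCommGroup V] [Module ℝ V]
    [FiniteDimensional ℝ V] (hdim : Module.finrank ℝ V = 2) {c : Fin 3 → V} {f : V →ₗ[ℝ] ℝ}
    (hf : ∀ i, 0 < f (c i)) :
    ∃ α β : ℝ, 0 ≤ α ∧ 0 ≤ β ∧ (c 1 = α • c 0 + β • c 2 ∨ c 0 = α • c 1 + β • c 2 ∨
      c 2 = α • c 0 + β • c 1) := by
  have hdep : ¬ LinearIndependent ℝ c := fun h ↦ by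
    have := h.fintype_card_le_finrank
    simp [hdim] at this
  obtain ⟨g₀, hg₀, i₀, hi₀⟩ := Fintype.not_linearIndependent_iff.1 hdep
  have key {x y z : V} {a b d : ℝ} (h : a • x + b • y + d • z = 0) (hy : b ≠ 0)
      (ha : a / b ≤ 0) (hd : d / b ≤ 0) :
      ∃ α β : ℝ, 0 ≤ α ∧ 0 ≤ β ∧ y = α • x + β • z := by
    refine ⟨-(a / b), -(d / b), by linarith, by linarith, ?_⟩
    have : b • y = b • (-(a / b) • x + -(d / b) • z) := by
      rw [smul_add, smul_smul, smul_smul, mul_neg, mul_neg, mul_div_cancel₀ _ hy,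
        mul_div_cancel₀ _ hy]
      linear_combination (norm := module) h
    exact smul_right_injective V hy this
  have main (g : Fin 3 → ℝ) (hg : g 0 • c 0 + g 1 • c 1 + g 2 • c 2 = 0) {i : Fin 3}
      (hi : 0 < g i) (hle : ∀ j, j ≠ i → g j ≤ 0) :
      ∃ α β : ℝ, 0 ≤ α ∧ 0 ≤ β ∧ (c 1 = α • c 0 + β • c 2 ∨ c 0 = α • c 1 + β • c 2 ∨
        c 2 = α • c 0 + β • c 1) := by
    fin_cases i
    · obtain ⟨α, β, h1, h2, h3⟩ := key (x := c 1) (y := c 0) (z := c 2)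
        ((add_comm _ _ |> congrArg (· + g 2 • c 2)).trans hg) hi.ne'
        (div_nonpos_of_nonpos_of_nonneg (hle 1 (by decide)) hi.le)
        (div_nonpos_of_nonpos_of_nonneg (hle 2 (by decide)) hi.le)
      exact ⟨α, β, h1, h2, .inr (.inl h3)⟩
    · obtain ⟨α, β, h1, h2, h3⟩ := key hg hi.ne'
        (div_nonpos_of_nonpos_of_nonneg (hle 0 (by decide)) hi.le)
        (div_nonpos_of_nonpos_of_nonneg (hle 2 (by decide)) hi.le)
      exact ⟨α, β, h1, h2, .inl h3⟩
    · obtain ⟨α, β, h1, h2, h3⟩ := key (x := c 0) (y := c 2) (z := c 1)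
        ((add_right_comm _ _ _).trans hg) hi.ne'
        (div_nonpos_of_nonpos_of_nonneg (hle 0 (by decide)) hi.le)
        (div_nonpos_of_nonpos_of_nonneg (hle 1 (by decide)) hi.le)
      exact ⟨α, β, h1, h2, .inr (.inr h3)⟩
  rw [Fin.sum_univ_three] at hg₀
  have hfg : g₀ 0 * f (c 0) + g₀ 1 * f (c 1) + g₀ 2 * f (c 2) = 0 := by
    simpa using congrArg f hg₀
  have hg₀' : (-g₀) 0 • c 0 + (-g₀) 1 • c 1 + (-g₀) 2 • c 2 = 0 := by
    simp only [Pi.neg_apply, neg_smul]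
    linear_combination (norm := module) -hg₀
  have m (i) (h : 0 ≤ g₀ i) : 0 ≤ g₀ i * f (c i) := mul_nonneg h (hf i).le
  have m' (i) (h : g₀ i ≤ 0) : g₀ i * f (c i) ≤ 0 := mul_nonpos_of_nonpos_of_nonneg h (hf i).le
  have n (i) (h : 0 < g₀ i) : 0 < g₀ i * f (c i) := mul_pos h (hf i)
  have n' (i) (h : g₀ i < 0) : g₀ i * f (c i) < 0 := mul_neg_of_neg_of_pos h (hf i)
  have hcases : (∃ i, 0 < g₀ i ∧ ∀ j, j ≠ i → g₀ j ≤ 0) ∨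
      (∃ i, g₀ i < 0 ∧ ∀ j, j ≠ i → 0 ≤ g₀ j) := by
    simp only [Fin.exists_fin_succ, Fin.forall_fin_succ]
    have hne : g₀ 0 ≠ 0 ∨ g₀ 1 ≠ 0 ∨ g₀ 2 ≠ 0 := by
      fin_cases i₀
      exacts [.inl hi₀, .inr (.inl hi₀), .inr (.inr hi₀)]
    have := m 0; have := m 1; have := m 2
    have := m' 0; have := m' 1; have := m' 2
    have := n 0; have := n 1; have := n 2
    have := n' 0; have := n' 1; have := n' 2
    simp
    grind
  rcases hcases with ⟨i, hi, hle⟩ | ⟨i, hi, hle⟩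
  · exact main g₀ hg₀ hi hle
  · exact main (-g₀) hg₀' (i := i) (by simpa using hi) (fun j hj ↦ by simpa using hle j hj)

lemma not_pos_relation_of_half_plane {V : Type*} [AddCommGroup V] [Module ℝ V]
    [FiniteDimensional ℝ V] (hdim : Module.finrank ℝ V = 2)
    {φ : Fin 3 → V →ₗ[ℝ] ℝ} {c : Fin 3 → V} {w : Fin 3 → ℝ} {f : V →ₗ[ℝ] ℝ}
    (h1 : ∀ i, φ i (c i) = 1) (hle : ∀ i j, φ i (c j) ≤ 1)
    (hgt : ∀ i j, -1 < φ i (c j)) (hw : ∀ i, 0 < w i) (hf : ∀ i, 0 < f (c i)) :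
    ∑ i, w i • φ i ≠ 0 := by
  intro h
  have hrel (v : V) : w 0 * φ 0 v + w 1 * φ 1 v + w 2 * φ 2 v = 0 := by
    simpa [Fin.sum_univ_three] using congrArg (fun ψ : V →ₗ[ℝ] ℝ ↦ ψ v) h
  obtain ⟨α, β, hα, hβ, hc | hc | hc⟩ := exists_mem_cone_of_half_plane hdim hf
  · exact false_of_mem_cone h1 hle hgt hw hrel hα hβ hc
  · exact false_of_mem_cone h1 hle hgt hw (fun v ↦ by linarith [hrel v]) hα hβ hc
  · exact false_of_mem_cone h1 hle hgt hw (fun v ↦ by linarith [hrel v]) hα hβ hc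

/-- The convex hull of a compact set in a finite-dimensional space is compact. -/
lemma isCompact_convexHull_of_isCompact {V : Type*} [NormedAddCommGroup V] [NormedSpace ℝ V]
    [FiniteDimensional ℝ V] {s : Set V} (hs : IsCompact s) : IsCompact (convexHull ℝ s) := by
  let n := Module.finrank ℝ V + 1
  let F : (Fin n → ℝ) × (Fin n → V) → V := fun p ↦ ∑ i, p.1 i • p.2 i
  have hF : Continuous F := by fun_prop
  have hcpt : IsCompact (stdSimplex ℝ (Fin n) ×ˢ Set.pi Set.univ fun _ : Fin n ↦ s) :=
    (isCompact_stdSimplex ℝ (Fin n)).prod (isCompact_univ_pi fun _ ↦ hs)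
  convert hcpt.image hF using 1
  refine Set.Subset.antisymm (fun x hx ↦ ?_) ?_
  · obtain ⟨ι, _, z, w, hz, hind, hw, hw1, rfl⟩ := eq_pos_convex_span_of_mem_convexHull hx
    have hcard : Fintype.card ι ≤ Fintype.card (Fin n) := by
      rw [Fintype.card_fin]
      exact hind.card_le_finrank_succ.trans (Nat.succ_le_succ (Submodule.finrank_le _))
    obtain ⟨e⟩ := Function.Embedding.nonempty_of_card_le hcard
    obtain ⟨i₀⟩ : Nonempty ι := by
      by_contra h
      rw [not_nonempty_iff] at h
      simp at hw1
    have hout (j : Fin n) (hj : j ∉ Set.range e) : Function.extend e w 0 j = 0 :=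
      Function.extend_apply' _ _ _ hj
    refine ⟨(Function.extend e w 0, Function.extend e z fun _ ↦ z i₀), ⟨⟨fun j ↦ ?_, ?_⟩, ?_⟩, ?_⟩
    · by_cases hj : j ∈ Set.range e
      · obtain ⟨i, rfl⟩ := hj
        simpa [e.injective.extend_apply] using (hw i).le
      · exact (hout j hj).ge
    · rw [← hw1]
      exact (Fintype.sum_of_injective e e.injective _ _ hout
        fun i ↦ by rw [e.injective.extend_apply]).symm
    · intro j _
      by_cases hj : j ∈ Set.range e
      · obtain ⟨i, rfl⟩ := hj
        simpa [e.injective.extend_apply] using hz (Set.mem_range_self i)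
      · simpa only [Function.extend_apply' _ _ _ hj] using hz (Set.mem_range_self i₀)
    · refine (Fintype.sum_of_injective e e.injective _ _ (fun j hj ↦ ?_) fun i ↦ ?_).symm
      · simp [hout j hj]
      · simp [e.injective.extend_apply]
  · rintro _ ⟨⟨w, z⟩, ⟨⟨hw, hw1⟩, hz⟩, rfl⟩
    exact (convex_convexHull ℝ s).sum_mem (fun i _ ↦ hw i) hw1
      fun i _ ↦ subset_convexHull ℝ s (hz i trivial)

/-- The functionals supporting the ball of radius `r` at a point of `C`, normalised to take the
value `1` there. -/
def supportFunctionals (C : Set E) (r : ℝ) : Set (StrongDual ℝ E) :=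
  {φ | ‖φ‖ ≤ r⁻¹ ∧ ∃ c ∈ C, φ c = 1}

lemma isCompact_supportFunctionals {C : Set E} (hC : IsCompact C) (r : ℝ) :
    IsCompact (supportFunctionals C r) := by
  have : ProperSpace (StrongDual ℝ E) := FiniteDimensional.proper ℝ _
  have h1 : IsCompact (Metric.closedBall (0 : StrongDual ℝ E) r⁻¹ ×ˢ C) :=
    (isCompact_closedBall _ _).prod hC
  have h2 : IsClosed {p : StrongDual ℝ E × E | p.1 p.2 = 1} :=
    isClosed_eq (by fun_prop) continuous_const
  convert (h1.inter_right h2).image continuous_fst using 1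
  ext φ
  simp [supportFunctionals, and_assoc]

lemma zero_notMem_convexHull_supportFunctionals (hdim : Module.finrank ℝ E = 2) {C : Set E} {r : ℝ}
    (hr : 0 < r) (hC : IsCompact C) (hCr : ∀ c ∈ C, ‖c‖ ≤ r)
    (hdist : ∀ c ∈ C, ∀ d ∈ C, ‖c - d‖ < 2 * r) (h0 : (0 : E) ∉ convexHull ℝ C) :
    (0 : StrongDual ℝ E) ∉ convexHull ℝ (supportFunctionals C r) := by
  intro hmem
  obtain ⟨f, u, hf0, hfu⟩ := geometric_hahn_banach_point_closed (convex_convexHull ℝ C)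
    (isCompact_convexHull_of_isCompact hC).isClosed h0
  rw [map_zero] at hf0
  obtain ⟨ι, _, φ, w, hφ, hind, hw, hw1, hsum⟩ := eq_pos_convex_span_of_mem_convexHull hmem
  have hφ' (i : ι) : ‖φ i‖ ≤ r⁻¹ ∧ ∃ c ∈ C, φ i c = 1 := hφ (Set.mem_range_self i)
  choose hnorm c hcC hφc using hφ'
  have hbound (i : ι) (v : E) : φ i v ≤ r⁻¹ * ‖v‖ :=
    (le_abs_self _).trans ((φ i).le_of_opNorm_le (hnorm i) v)
  have hle (i j : ι) : φ i (c j) ≤ 1 := by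
    refine (hbound i (c j)).trans ?_
    calc r⁻¹ * ‖c j‖ ≤ r⁻¹ * r := by gcongr; exact hCr _ (hcC j)
      _ = 1 := inv_mul_cancel₀ hr.ne'
  have hgt (i j : ι) : -1 < φ i (c j) := by
    have h := hbound i (c i - c j)
    have h' : r⁻¹ * ‖c i - c j‖ < r⁻¹ * (2 * r) := by
      have := inv_pos.2 hr
      gcongr
      exact hdist _ (hcC i) _ (hcC j)
    have h'' : r⁻¹ * (2 * r) = 2 := by field_simp
    rw [map_sub, hφc] at h
    linarith
  have hcard : Fintype.card ι ≤ 3 := by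
    refine hind.card_le_finrank_succ.trans ?_
    have h := Submodule.finrank_le (vectorSpan ℝ (Set.range φ))
    have h2 : Module.finrank ℝ (StrongDual ℝ E) = 2 := by
      rw [← (LinearMap.toContinuousLinearMap (𝕜 := ℝ) (E := E) (F' := ℝ)).finrank_eq,
        ← hdim]
      exact Subspace.dual_finrank_eq
    omega
  obtain ⟨n, ⟨e⟩⟩ : ∃ n, Nonempty (Fin n ≃ ι) := ⟨_, ⟨(Fintype.equivFin ι).symm⟩⟩
  have hn : n ≤ 3 := by simpa [← Fintype.card_congr e] using hcard
  have hsum' (v : E) : ∑ i, w (e i) * φ (e i) v = 0 := by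
    rw [e.sum_comp fun i ↦ w i * φ i v]
    simpa using congrArg (fun ψ : StrongDual ℝ E ↦ ψ v) hsum
  rw [← e.sum_comp] at hw1
  interval_cases n
  · simp at hw1
  · have h0 := hsum' (c (e 0))
    simp only [Fin.sum_univ_one, hφc, mul_one] at h0
    exact absurd h0 (hw _).ne'
  · have h0 := hsum' (c (e 0))
    have h1 := hsum' (c (e 1))
    simp only [Fin.sum_univ_two, hφc] at h0 h1
    nlinarith [hgt (e 0) (e 1), hgt (e 1) (e 0), hw (e 0), hw (e 1)]
  · refine not_pos_relation_of_half_plane hdim (φ := fun i ↦ (φ (e i)).toLinearMap)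
      (c := fun i ↦ c (e i)) (w := fun i ↦ w (e i)) (f := f.toLinearMap) (fun i ↦ hφc _)
      (fun i j ↦ hle _ _) (fun i j ↦ hgt _ _) (fun i ↦ hw _)
      (fun i ↦ hf0.trans (hfu _ (subset_convexHull ℝ C (hcC _)))) ?_
    ext v
    simpa using hsum' v

/-- If no nonnegative combination of supporting functionals vanishes, some direction is strictly
positive on all of them. -/
lemma exists_pos_on_supportFunctionals {C : Set E} {r : ℝ} (hC : IsCompact C)
    (h0 : (0 : StrongDual ℝ E) ∉ convexHull ℝ (supportFunctionals C r)) :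
    ∃ v : E, ∀ φ ∈ supportFunctionals C r, 0 < φ v := by
  obtain ⟨F, u, hF0, hFu⟩ := geometric_hahn_banach_point_closed (convex_convexHull ℝ _)
    (isCompact_convexHull_of_isCompact (isCompact_supportFunctionals hC r)).isClosed h0
  rw [map_zero] at hF0
  let G : Module.Dual ℝ (Module.Dual ℝ E) :=
    F.toLinearMap ∘ₗ (LinearMap.toContinuousLinearMap (𝕜 := ℝ) (E := E) (F' := ℝ)).toLinearMap
  refine ⟨(Module.evalEquiv ℝ E).symm G, fun φ hφ ↦ ?_⟩
  have h1 : (φ : E →ₗ[ℝ] ℝ) ((Module.evalEquiv ℝ E).symm G) = G (φ : E →ₗ[ℝ] ℝ) :=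
    Module.apply_evalEquiv_symm_apply ℝ E (φ : E →ₗ[ℝ] ℝ) G
  have h2 : G (φ : E →ₗ[ℝ] ℝ) = F φ := rfl
  change 0 < (φ : E →ₗ[ℝ] ℝ) ((Module.evalEquiv ℝ E).symm G)
  rw [h1, h2]
  exact hF0.trans (hFu φ (subset_convexHull ℝ _ hφ))

/-- If a direction is strictly positive on the functionals supporting the ball of radius `r` at
its contact points with `K`, moving the centre in that direction allows a smaller radius. -/
lemma exists_smaller_closedBall {K : Set E} {r : ℝ} (hr : 0 < r) (hK : IsCompact K)
    (hKr : ∀ k ∈ K, ‖k‖ ≤ r) {v : E}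
    (hv : ∀ φ ∈ supportFunctionals (K ∩ Metric.sphere 0 r) r, 0 < φ v) :
    ∃ y : E, ∃ ρ < r, K ⊆ Metric.closedBall y ρ := by
  have : ProperSpace (StrongDual ℝ E) := FiniteDimensional.proper ℝ _
  let T : Set (StrongDual ℝ E × E) := (Metric.closedBall 0 r⁻¹ ×ˢ K) ∩ {p | p.1 v ≤ 0}
  have hT : IsCompact T :=
    ((isCompact_closedBall _ _).prod hK).inter_right (isClosed_le (by fun_prop) continuous_const)
  have hle (φ : StrongDual ℝ E) (hφ : ‖φ‖ ≤ r⁻¹) (k : E) : φ k ≤ r⁻¹ * ‖k‖ :=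
    (le_abs_self _).trans (φ.le_of_opNorm_le hφ k)
  have hT1 : ∀ p ∈ T, p.1 p.2 < 1 := by
    rintro ⟨φ, k⟩ ⟨⟨hφ, hk⟩, hφv⟩
    simp only [Metric.mem_closedBall, dist_zero_right] at hφ
    have hbound : φ k ≤ r⁻¹ * ‖k‖ := hle φ hφ k
    by_contra! h
    simp only at h
    have hkr : ‖k‖ = r := by
      refine le_antisymm (hKr k hk) ?_
      have := h.trans hbound
      rwa [inv_mul_eq_div, le_div_iff₀ hr, one_mul] at this
    rw [hkr, inv_mul_cancel₀ hr.ne'] at hbound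
    exact (hv φ ⟨hφ, k, ⟨hk, by simpa using hkr⟩, le_antisymm hbound h⟩).not_ge hφv
  obtain ⟨M, hM1, hM⟩ : ∃ M < 1, ∀ p ∈ T, p.1 p.2 ≤ M := by
    rcases T.eq_empty_or_nonempty with hT0 | hTne
    · exact ⟨0, one_pos, by simp [hT0]⟩
    · obtain ⟨p, hp, hpmax⟩ := hT.exists_isMaxOn (f := fun p ↦ p.1 p.2) hTne (by fun_prop)
      exact ⟨_, hT1 p hp, fun q hq ↦ hpmax hq⟩
  obtain ⟨ε, hε, hεM⟩ : ∃ ε > 0, M + ε * (r⁻¹ * ‖v‖) < 1 := by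
    have hb : 0 ≤ r⁻¹ * ‖v‖ := by positivity
    have hpos : 0 < r⁻¹ * ‖v‖ + 1 := by linarith
    refine ⟨(1 - M) / (r⁻¹ * ‖v‖ + 1), div_pos (by linarith) hpos, ?_⟩
    have h := div_mul_cancel₀ (1 - M) hpos.ne'
    have h' : 0 < (1 - M) / (r⁻¹ * ‖v‖ + 1) := div_pos (by linarith) hpos
    linarith
  have hlt : ∀ k ∈ K, ‖k - ε • v‖ < r := by
    intro k hk
    by_contra! h
    obtain ⟨ψ, hψ, hψk⟩ := exists_dual_vector'' ℝ (k - ε • v)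
    simp only [RCLike.ofReal_real_eq_id, id] at hψk
    have hri := inv_pos.2 hr
    have hφ : ‖r⁻¹ • ψ‖ ≤ r⁻¹ := by
      rw [norm_smul, Real.norm_of_nonneg hri.le]
      exact mul_le_of_le_one_right hri.le hψ
    have h1 : 1 ≤ (r⁻¹ • ψ) k - ε * (r⁻¹ • ψ) v := by
      have : (r⁻¹ • ψ) (k - ε • v) = r⁻¹ * ‖k - ε • v‖ := by simp [hψk]
      rw [map_sub, map_smul, smul_eq_mul] at this
      rw [this, inv_mul_eq_div, one_le_div hr]
      exact h
    have h2 : (r⁻¹ • ψ) k ≤ 1 := by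
      refine (hle _ hφ k).trans ?_
      rw [inv_mul_eq_div, div_le_one hr]
      exact hKr k hk
    have h3 : (r⁻¹ • ψ) v ≤ 0 := by
      by_contra! h3
      have := mul_pos hε h3
      linarith
    have h4 : (r⁻¹ • ψ) k ≤ M := hM (r⁻¹ • ψ, k) ⟨⟨by simpa using hφ, hk⟩, h3⟩
    have h5 : -(r⁻¹ • ψ) v ≤ r⁻¹ * ‖v‖ := by
      simpa using hle _ hφ (-v)
    have h6 := mul_le_mul_of_nonneg_left h5 hε.le
    linarith
  rcases K.eq_empty_or_nonempty with rfl | hne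
  · exact ⟨0, 0, hr, by simp⟩
  · obtain ⟨k, hk, hmax⟩ := hK.exists_isMaxOn (f := fun k ↦ ‖k - ε • v‖) hne (by fun_prop)
    exact ⟨ε • v, _, hlt k hk, fun y hy ↦ by simpa [dist_eq_norm] using hmax hy⟩

lemma exists_affineIndependent_mem_interior (hdim : Module.finrank ℝ E = 2) {C : Set E} {r : ℝ}
    {x : E} (hr : 0 < r) (hCr : ∀ c ∈ C, dist c x = r)
    (hdist : ∀ c ∈ C, ∀ d ∈ C, dist c d < 2 * r) (hx : x ∈ convexHull ℝ C) :
    ∃ t : Fin 3 → E, AffineIndependent ℝ t ∧ (∀ i, t i ∈ C) ∧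
      x ∈ interior (convexHull ℝ (Set.range t)) := by
  obtain ⟨ι, _, z, w, hz, hind, hw, hw1, hsum⟩ := eq_pos_convex_span_of_mem_convexHull hx
  have hcard : Fintype.card ι ≤ 3 := by
    refine hind.card_le_finrank_succ.trans ?_
    have h := Submodule.finrank_le (vectorSpan ℝ (Set.range z))
    omega
  obtain ⟨n, ⟨e⟩⟩ : ∃ n, Nonempty (Fin n ≃ ι) := ⟨_, ⟨(Fintype.equivFin ι).symm⟩⟩
  have hn : n ≤ 3 := by simpa [← Fintype.card_congr e] using hcard
  have hzC (i : Fin n) : z (e i) ∈ C := hz (Set.mem_range_self _)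
  have hind' : AffineIndependent ℝ fun i ↦ z (e i) := hind.comp_embedding e.toEmbedding
  rw [← e.sum_comp] at hw1 hsum
  interval_cases n
  · simp at hw1
  · simp only [Fin.sum_univ_one] at hw1 hsum
    rw [hw1, one_smul] at hsum
    have := hCr _ (hzC 0)
    rw [hsum, dist_self] at this
    exact absurd this hr.ne
  · simp only [Fin.sum_univ_two] at hw1 hsum
    have h0 := hCr _ (hzC 0)
    have h1 := hCr _ (hzC 1)
    have h01 := hdist _ (hzC 0) _ (hzC 1)
    rw [dist_eq_norm] at h0 h1 h01
    have e0 : z (e 0) - x = w (e 1) • (z (e 0) - z (e 1)) := by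
      rw [← hsum, eq_sub_of_add_eq hw1]; module
    have e1 : z (e 1) - x = -(w (e 0) • (z (e 0) - z (e 1))) := by
      rw [← hsum, eq_sub_of_add_eq' hw1]; module
    rw [e0, norm_smul, Real.norm_of_nonneg (hw _).le] at h0
    rw [e1, norm_neg, norm_smul, Real.norm_of_nonneg (hw _).le] at h1
    have : (w (e 0) + w (e 1)) * ‖z (e 0) - z (e 1)‖ = 2 * r := by linarith
    rw [hw1, one_mul] at this
    linarith
  · refine ⟨fun i ↦ z (e i), hind', hzC, ?_⟩
    let b : AffineBasis (Fin 3) ℝ E := ⟨fun i ↦ z (e i), hind',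
      (hind'.affineSpan_eq_top_iff_card_eq_finrank_add_one).2 (by simp [hdim])⟩
    have hb : (b : Fin 3 → E) = fun i ↦ z (e i) := rfl
    rw [← hb, b.interior_convexHull]
    intro i
    have := b.coord_apply_combination_of_mem (Finset.mem_univ i) hw1
    rw [Finset.affineCombination_eq_linear_combination _ _ _ hw1, hb, hsum] at this
    rw [this]
    exact hw _

lemma chebRadius_le {V : Type*} [NormedAddCommGroup V] {K : Set V} (hK : K.Nonempty) {y : V} {ρ : ℝ}
    (h : K ⊆ Metric.closedBall y ρ) : chebRadius K ≤ ρ := by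
  refine csInf_le ⟨0, ?_⟩ ⟨y, h⟩
  rintro s ⟨z, hz⟩
  obtain ⟨k, hk⟩ := hK
  exact dist_nonneg.trans (hz hk)

theorem exists_critical_simplex_of_noncentrable (hdim : Module.finrank ℝ E = 2)
    (K : Set E) (hK : K.Nonempty) (hc : IsCompact K) (hconv : Convex ℝ K)
    (hnc : Metric.diam K < 2 * chebRadius K)
    (x : E) (hx : x ∈ chebSet K) :
    ∃ m : ℕ, (m = 2 ∨ m = 3) ∧ ∃ t : Fin m → E,
      AffineIndependent ℝ t ∧ (∀ i, t i ∈ critSet K x) ∧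
      x ∈ intrinsicInterior ℝ (convexHull ℝ (Set.range t)) := by
  have hr : 0 < chebRadius K := by
    have := Metric.diam_nonneg (s := K)
    linarith
  have hdist (c) (hcK : c ∈ critSet K x) (d) (hdK : d ∈ critSet K x) :
      dist c d < 2 * chebRadius K :=
    (Metric.dist_le_diam_of_mem hc.isBounded hcK.1 hdK.1).trans_lt hnc
  suffices hmem : x ∈ convexHull ℝ (critSet K x) by
    obtain ⟨t, ht, htC, hxt⟩ :=
      exists_affineIndependent_mem_interior hdim hr (fun c hcK ↦ hcK.2) hdist hmem
    exact ⟨3, .inr rfl, t, ht, htC, interior_subset_intrinsicInterior hxt⟩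
  by_contra hmem
  let K₀ : Set E := (fun y ↦ -x + y) '' K
  let C : Set E := K₀ ∩ Metric.sphere 0 (chebRadius K)
  have hK₀ : IsCompact K₀ := hc.image (by fun_prop)
  have hC : IsCompact C := hK₀.inter_right Metric.isClosed_sphere
  have hcrit : (fun y ↦ -x + y) '' critSet K x = C := by
    rw [critSet, Set.image_inter (add_right_injective _)]
    congr 1
    ext y
    simp
  have h0 : (0 : E) ∉ convexHull ℝ C := by
    have h := convexHull_vadd (𝕜 := ℝ) (-x) (critSet K x)
    rw [← hcrit]
    change (0 : E) ∉ convexHull ℝ (Set.image (-x +ᵥ ·) (critSet K x))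
    rw [Set.image_vadd, h]
    rintro ⟨y, hy, hxy⟩
    have hxy : -x + y = 0 := hxy
    rw [neg_add_eq_zero] at hxy
    exact hmem (hxy ▸ hy)
  have hK₀r : ∀ k ∈ K₀, ‖k‖ ≤ chebRadius K := by
    rintro _ ⟨k, hk, rfl⟩
    simpa [dist_eq_norm, neg_add_eq_sub] using hx hk
  have hCdist : ∀ c ∈ C, ∀ d ∈ C, ‖c - d‖ < 2 * chebRadius K := by
    rw [← hcrit]
    rintro _ ⟨c, hcK, rfl⟩ _ ⟨d, hdK, rfl⟩
    simpa [dist_eq_norm] using hdist c hcK d hdK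
  obtain ⟨v, hv⟩ := exists_pos_on_supportFunctionals hC
    (zero_notMem_convexHull_supportFunctionals hdim hr hC (fun c hcC ↦ hK₀r c hcC.1) hCdist h0)
  obtain ⟨y, ρ, hρ, hy⟩ := exists_smaller_closedBall hr hK₀ hK₀r hv
  refine hρ.not_ge (chebRadius_le hK (y := x + y) fun k hk ↦ ?_)
  have := hy ⟨k, hk, rfl⟩
  rw [Metric.mem_closedBall, dist_eq_norm] at this ⊢
  rwa [← sub_sub, ← neg_add_eq_sub x k]
end

section
/- Let E be a two-dimensional real normed space, and let p, q, x ∈ E satisfy p ≠ q, ‖p‖ ≤ 1, ‖q‖ ≤ 1, ‖p − q‖ ≤ 1, and ‖p − x‖ = ‖q − x‖ = 1. Let f : E → ℝ be a nonzero continuous linear functional with f(p) = f(q) and f(x) ≤ f(p), and suppose that S(x, 1) ∩ {y : f(y) = f(p)} = {p, q} (so that {y ∈ S(x, 1) : f(y) ≥ f(p)} is the minimal circular arc of S(x, 1) with endpoints p and q, lying in the half-plane bounded by the line through p and q that does not contain x). Then this minimal circular arc is contained in the unit ball: every y ∈ E with ‖y − x‖ = 1 and f(y) ≥ f(p) satisfies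 ‖y‖ ≤ 1. -/
open Metric Set

variable {E : Type*} [NormedAddCommGroup E] [NormedSpace ℝ E] [FiniteDimensional ℝ E]

section

variable {F : Type*} [NormedAddCommGroup F] [NormedSpace ℝ F]

/-- If `u`, `v`, `u - v` and the differences of `u`, `v` with `s • u + t • v` have norm at most `1`,
where `s` and `t` are nonpositive and `u` has norm `1`, then `s = 0`. -/
lemma coeff_eq_zero_of_nonpos {u v : F} {s t : ℝ} (hu : ‖u‖ = 1) (huv : ‖u - v‖ ≤ 1)
    (huo : ‖u - (s • u + t • v)‖ ≤ 1) (hs : s ≤ 0) (ht : t ≤ 0) : s = 0 := by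
  have key : (1 - s - t) • u = (u - (s • u + t • v)) + (-t) • (u - v) := by module
  have h := norm_add_le (u - (s • u + t • v)) ((-t) • (u - v))
  rw [← key, norm_smul, norm_smul, Real.norm_of_nonneg (by linarith),
    Real.norm_of_nonneg (by linarith), hu] at h
  nlinarith

/-- If the segment from `0` to `z` meets the segment from `u` to `o`, where `u` and `z` are unit
vectors and `u` is within distance `1` of `o`, then so is `z`. -/
lemma norm_sub_le_one_of_segments_meet {u z o : F} {l r : ℝ} (hu : ‖u‖ = 1) (hz : ‖z‖ = 1)
    (huo : ‖u - o‖ ≤ 1) (hl : 0 ≤ l) (hl1 : l ≤ 1) (hr : 0 ≤ r) (hr1 : r ≤ 1)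
    (h : l • z = (1 - r) • u + r • o) : ‖z - o‖ ≤ 1 := by
  have e₁ : z - o = (1 - l) • z + (1 - r) • (u - o) := by
    rw [sub_smul, h]
    module
  have e₂ : u = l • z + r • (u - o) := by
    rw [h]
    module
  have h₁ := norm_add_le ((1 - l) • z) ((1 - r) • (u - o))
  have h₂ := norm_add_le (l • z) (r • (u - o))
  rw [← e₁, norm_smul, norm_smul, Real.norm_of_nonneg (by linarith),
    Real.norm_of_nonneg (by linarith), hz] at h₁
  rw [← e₂, norm_smul, norm_smul, Real.norm_of_nonneg hl, Real.norm_of_nonneg hr, hz, hu] at h₂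
  nlinarith

/-- A point of the triangle with vertices `u`, `v`, `o` is within distance `1` of `o` as soon as
`u` and `v` are. -/
lemma norm_sub_le_one_of_mem_triangle {u v z o : F} {A B : ℝ} (huo : ‖u - o‖ ≤ 1)
    (hvo : ‖v - o‖ ≤ 1) (hA : 0 ≤ A) (hB : 0 ≤ B) (hAB : A + B ≤ 1)
    (h : z - o = A • (u - o) + B • (v - o)) : ‖z - o‖ ≤ 1 := by
  have h₁ := norm_add_le (A • (u - o)) (B • (v - o))
  rw [← h, norm_smul, norm_smul, Real.norm_of_nonneg hA, Real.norm_of_nonneg hB] at h₁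
  nlinarith

/-- The arc estimate in coordinates with respect to the endpoints `u`, `v` of the arc, for a center
`s • u + t • v` on the same side of the line through `0` and `a • u + b • v` as `v`. -/
lemma norm_sub_le_one_of_det_nonneg {u v : F} {a b s t : ℝ} (hu : ‖u‖ = 1) (hv : ‖v‖ = 1)
    (huv : ‖u - v‖ ≤ 1) (hz : ‖a • u + b • v‖ = 1)
    (huo : ‖u - (s • u + t • v)‖ ≤ 1) (hvo : ‖v - (s • u + t • v)‖ ≤ 1)
    (ha : 0 ≤ a) (hb : 0 ≤ b) (hab : 1 ≤ a + b) (hdet : 0 ≤ a * t - b * s) :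
    ‖(a • u + b • v) - (s • u + t • v)‖ ≤ 1 := by
  rcases hb.eq_or_lt with rfl | hb
  · rw [zero_smul, add_zero, norm_smul, hu, mul_one, Real.norm_of_nonneg ha] at hz
    simpa [hz] using huo
  have hD : 0 < b + (a * t - b * s) := by linarith
  rcases le_or_gt t 0 with ht | ht
  · have hs : s ≤ 0 := by
      by_contra! hs
      nlinarith [mul_pos hb hs, mul_nonneg ha (neg_nonneg.2 ht)]
    have hs0 := coeff_eq_zero_of_nonpos hu huv huo hs ht
    have ht0 := coeff_eq_zero_of_nonpos (s := t) (t := s) hv (by rwa [norm_sub_rev])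
      (by rwa [add_comm (t • v)]) ht hs
    simp [hs0, ht0, hz]
  rcases le_or_gt t (b + (a * t - b * s)) with htD | htD
  · obtain ⟨D, hDe⟩ : ∃ D, D = b + (a * t - b * s) := ⟨_, rfl⟩
    rw [← hDe] at hD htD
    refine norm_sub_le_one_of_segments_meet (l := t / D) (r := b / D) hu hz huo (by positivity)
      ((div_le_one hD).2 htD) (by positivity) ((div_le_one hD).2 (by linarith)) ?_
    match_scalars
    · field_simp
      linarith
    · field_simp
  · have hst : 0 < s + t - 1 := by
      have : 0 < b * (s + t - 1) := by nlinarith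
      exact pos_of_mul_pos_right this hb.le
    have hA : 0 ≤ a * t - b * s + s - a := by
      rcases le_or_gt 0 s with hs | hs
      · have : 0 ≤ t * (a * t - b * s + s - a) := by
          nlinarith [mul_nonneg hdet hst.le, mul_nonneg hs (sub_nonneg.2 htD.le)]
        exact nonneg_of_mul_nonneg_right this ht
      · nlinarith [mul_nonneg ha hst.le, mul_nonneg (neg_nonneg.2 hs.le) (sub_nonneg.2 hab)]
    refine norm_sub_le_one_of_mem_triangle (A := (a * t - b * s + s - a) / (s + t - 1))
      (B := (t - (b + (a * t - b * s))) / (s + t - 1)) huo hvo (div_nonneg hA hst.le)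
      (div_nonneg (by linarith) hst.le) ?_ ?_
    · rw [← add_div, div_le_one hst]
      linarith
    · match_scalars
      · field_simp
        ring
      · field_simp
        ring

/-- If `a • u + b • v` is a unit vector with `1 ≤ a + b` and `b < 0`, it lies on the line through
the unit vectors `u` and `v`. -/
lemma add_eq_one_of_coeff_neg {u v : F} {a b : ℝ} (hu : ‖u‖ = 1) (hv : ‖v‖ = 1)
    (hz : ‖a • u + b • v‖ = 1) (hab : 1 ≤ a + b) (hb : b < 0) : a + b = 1 := by
  have key : a • u = (a • u + b • v) + (-b) • v := by module
  have h := norm_add_le (a • u + b • v) ((-b) • v)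
  rw [← key, norm_smul, norm_smul, Real.norm_of_nonneg (by linarith),
    Real.norm_of_nonneg (by linarith), hu, hv, hz] at h
  linarith

end

theorem minimal_arc_subset_unit_ball (hdim : Module.finrank ℝ E = 2)
    (p q x : E) (hpq : p ≠ q)
    (hp : ‖p‖ ≤ 1) (hq : ‖q‖ ≤ 1) (hdist : ‖p - q‖ ≤ 1)
    (hpx : ‖p - x‖ = 1) (hqx : ‖q - x‖ = 1)
    (f : E →L[ℝ] ℝ) (hf : f ≠ 0) (hfpq : f p = f q) (hfx : f x ≤ f p)
    (harc : {y : E | ‖y - x‖ = 1 ∧ f y = f p} = {p, q}) :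
    ∀ y : E, ‖y - x‖ = 1 → f p ≤ f y → ‖y‖ ≤ 1 := by
  intro y hy hfy
  obtain ⟨u, rfl⟩ : ∃ u, p = x + u := ⟨p - x, by abel⟩
  obtain ⟨v, rfl⟩ : ∃ v, q = x + v := ⟨q - x, by abel⟩
  obtain ⟨z, rfl⟩ : ∃ z, y = x + z := ⟨y - x, by abel⟩
  simp only [add_sub_cancel_left, add_sub_add_left_eq_sub, map_add, add_le_add_iff_left,
    add_right_inj, le_add_iff_nonneg_right, ne_eq] at *
  have hline (w : E) (hw : ‖w‖ = 1) (hfw : f w = f u) : w = u ∨ w = v := by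
    have : x + w ∈ ({x + u, x + v} : Set E) := by
      rw [← harc]
      simp [hw, hfw]
    simpa using this
  have hc : 0 < f u := by
    refine hfx.lt_of_ne fun h0 => ?_
    rcases hline (-u) (by rwa [norm_neg]) (by rw [map_neg, ← h0, neg_zero]) with h | h
    · have h2 : (2 : ℝ) • u = 0 := by rw [two_smul, ← sub_neg_eq_add, h, sub_self]
      simp [(smul_eq_zero.1 h2).resolve_left two_ne_zero] at hpx
    · rw [← h, sub_neg_eq_add, ← two_smul ℝ, norm_smul, hpx] at hdist
      norm_num at hdist
  have hli : LinearIndependent ℝ ![u, v] := by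
    rw [LinearIndependent.pair_iff]
    intro α β h
    have h' := congrArg f h
    simp only [map_add, map_smul, smul_eq_mul, map_zero, ← hfpq, ← add_mul] at h'
    have hβ : β = -α := by linarith [(mul_eq_zero.1 h').resolve_right hc.ne']
    subst hβ
    have h2 : α • (u - v) = 0 := by rw [← h]; module
    have hα := (smul_eq_zero.1 h2).resolve_right (sub_ne_zero.2 hpq)
    simp [hα]
  have hspan (w : E) : ∃ a b : ℝ, a • u + b • v = w := by
    have h := hli.span_eq_top_of_card_eq_finrank (by simp [hdim])
    rw [Matrix.range_cons, Matrix.range_cons, Matrix.range_empty, union_empty,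
      singleton_union] at h
    exact Submodule.mem_span_pair.1 (h ▸ Submodule.mem_top)
  obtain ⟨a, b, rfl⟩ := hspan z
  obtain ⟨s, t, ho⟩ := hspan (-x)
  obtain rfl : x = -(s • u + t • v) := by rw [ho, neg_neg]
  simp only [neg_add_eq_sub] at *
  have hfz : f (a • u + b • v) = (a + b) * f u := by
    simp only [map_add, map_smul, smul_eq_mul, ← hfpq]
    ring
  have hab : 1 ≤ a + b := by
    rw [hfz] at hfy
    exact le_of_mul_le_mul_right (by linarith) hc
  by_cases hone : a + b = 1
  · rcases hline _ hy (by rw [hfz, hone, one_mul]) with h | h <;> rw [h] <;> assumption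
  have hb : 0 ≤ b := by
    by_contra! hb
    exact hone (add_eq_one_of_coeff_neg hpx hqx hy hab hb)
  have ha : 0 ≤ a := by
    by_contra! ha
    rw [add_comm (a • u)] at hy
    exact hone (by linarith [add_eq_one_of_coeff_neg hqx hpx hy (by linarith) ha])
  rcases le_total 0 (a * t - b * s) with hdet | hdet
  · exact norm_sub_le_one_of_det_nonneg hpx hqx hdist hy hp hq ha hb hab hdet
  · rw [add_comm (a • u)] at hy ⊢
    rw [add_comm (s • u)] at hp hq ⊢
    exact norm_sub_le_one_of_det_nonneg hqx hpx (by rwa [norm_sub_rev]) hy hq hp hb ha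
      (by linarith) (by linarith)
end
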